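/- Surjectivity of the steady-state loop gain operator: Let A ∈ ℝ^{n×n} be Hurwitz, B ∈ ℝ^{n×m}, C ∈ ℝ^{r×n}, D ∈ ℝ^{r×m}, and Φ ∈ ℝ^{rq×rq} with all eigenvalues purely imaginary. Define ℒ(F) = C·Syl⁻¹(BF) + DF where Syl(Π) = ΠΦ − AΠ. Then ℒ: ℝ^{m×rq} → ℝ^{r×rq} is surjective if and only if for every eigenvalue λ of Φ, the (n+r)×(n+m) matrix [[A − λI, B], [C, D]] has rank n + r. -/

import Mathlib

open Matrix Complex

/-- A nonzero invariant subspace of a complex endomorphism contains an eigenvector. -/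
theorem Module.End.exists_eigenvector_mem {V : Type*} [AddCommGroup V] [Module ℂ V]
    [FiniteDimensional ℂ V] (f : Module.End ℂ V) (S : Submodule ℂ V)
    (hS : ∀ x ∈ S, f x ∈ S) {x : V} (hx : x ∈ S) (hx0 : x ≠ 0) :
    ∃ μ : ℂ, ∃ y ∈ S, y ≠ 0 ∧ f y = μ • y := by
  have : Nontrivial S := ⟨⟨x, hx⟩, 0, fun h => hx0 (congrArg Subtype.val h)⟩
  obtain ⟨μ, hμ⟩ := Module.End.exists_eigenvalue (f.restrict hS)
  obtain ⟨y, hy⟩ := hμ.exists_hasEigenvector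
  exact ⟨μ, y, y.2, fun h => hy.2 (Subtype.ext h), congrArg Subtype.val hy.apply_eq_smul⟩

namespace Matrix

variable {n m r k : Type*}

theorem mem_spectrum_of_mul_eq_smul [Fintype n] [DecidableEq n]
    {X : Matrix n n ℂ} {P : Matrix n k ℂ} {μ : ℂ}
    (hP : P ≠ 0) (h : X * P = μ • P) : μ ∈ spectrum ℂ X := by
  rw [spectrum.mem_iff, Algebra.algebraMap_eq_smul_one]
  rintro ⟨u, hu⟩
  refine hP ?_
  have h0 : (u : Matrix n n ℂ) * P = 0 := by
    rw [hu, Matrix.sub_mul, h, Matrix.smul_mul, Matrix.one_mul, sub_self]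
  simpa [← Matrix.mul_assoc] using congrArg ((↑u⁻¹ : Matrix n n ℂ) * ·) h0

theorem mem_spectrum_of_mul_eq_smul' [Fintype k] [DecidableEq k]
    {Y : Matrix k k ℂ} {P : Matrix n k ℂ} {μ : ℂ}
    (hP : P ≠ 0) (h : P * Y = μ • P) : μ ∈ spectrum ℂ Y := by
  rw [spectrum.mem_iff, Algebra.algebraMap_eq_smul_one]
  rintro ⟨u, hu⟩
  refine hP ?_
  have h0 : P * (u : Matrix k k ℂ) = 0 := by
    rw [hu, Matrix.mul_sub, h, Matrix.mul_smul, Matrix.mul_one, sub_self]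
  simpa [Matrix.mul_assoc] using congrArg (· * (↑u⁻¹ : Matrix k k ℂ)) h0

theorem exists_mulVec_eq_smul_of_mem_spectrum [Fintype n] [DecidableEq n]
    {X : Matrix n n ℂ} {μ : ℂ}
    (h : μ ∈ spectrum ℂ X) : ∃ v ≠ 0, X *ᵥ v = μ • v := by
  rw [spectrum.mem_iff, Algebra.algebraMap_eq_smul_one, Matrix.isUnit_iff_isUnit_det,
    isUnit_iff_ne_zero, not_not] at h
  obtain ⟨v, hv, h⟩ := Matrix.exists_mulVec_eq_zero_iff.2 h
  refine ⟨v, hv, ?_⟩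
  rw [sub_mulVec, smul_mulVec, one_mulVec, sub_eq_zero] at h
  exact h.symm

/-- Sylvester's theorem: matrices with disjoint spectra have no nonzero intertwiner. -/
theorem eq_zero_of_mul_eq_mul
    [Fintype n] [Fintype k] [DecidableEq n] [DecidableEq k]
    {X : Matrix n n ℂ} {Y : Matrix k k ℂ}
    (hXY : Disjoint (spectrum ℂ X) (spectrum ℂ Y)) {P : Matrix n k ℂ} (h : X * P = P * Y) :
    P = 0 := by
  by_contra hP
  let f : Module.End ℂ (Matrix n k ℂ) := mulLeftLinearMap k ℂ X
  let g : Module.End ℂ (Matrix n k ℂ) := mulRightLinearMap n ℂ Y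
  obtain ⟨μ, Q, hQ, hQ0, hμ⟩ := Module.End.exists_eigenvector_mem f (LinearMap.eqLocus f g)
    (fun Q (hQ : X * Q = Q * Y) => show X * (X * Q) = X * Q * Y by
      rw [Matrix.mul_assoc X Q Y, ← hQ]) h hP
  have hQ : X * Q = Q * Y := hQ
  have hμ : X * Q = μ • Q := hμ
  exact Set.disjoint_left.1 hXY (mem_spectrum_of_mul_eq_smul hQ0 hμ)
    (mem_spectrum_of_mul_eq_smul' hQ0 (hQ ▸ hμ))

theorem map_ofReal_mul [Fintype m]
    (X : Matrix n m ℝ) (Y : Matrix m k ℝ) :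
    (X * Y).map Complex.ofReal = X.map Complex.ofReal * Y.map Complex.ofReal :=
  Matrix.map_mul (f := Complex.ofRealHom)

theorem eq_zero_of_mul_eq_mul_real
    [Fintype n] [Fintype k] [DecidableEq n] [DecidableEq k]
    {X : Matrix n n ℝ} {Y : Matrix k k ℝ}
    (hXY : Disjoint (spectrum ℂ (X.map Complex.ofReal)) (spectrum ℂ (Y.map Complex.ofReal)))
    {P : Matrix n k ℝ} (h : X * P = P * Y) : P = 0 := by
  have := eq_zero_of_mul_eq_mul hXY (P := P.map Complex.ofReal)
    (by rw [← map_ofReal_mul, h, map_ofReal_mul])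
  ext i j
  simpa using congrFun₂ this i j

/-- The Sylvester operator `P ↦ P Y - X P`. -/
def sylvester [Fintype n] [Fintype k]
    (X : Matrix n n ℝ) (Y : Matrix k k ℝ) : Module.End ℝ (Matrix n k ℝ) :=
  mulRightLinearMap n ℝ Y - mulLeftLinearMap k ℝ X

theorem sylvester_apply [Fintype n] [Fintype k]
    (X : Matrix n n ℝ) (Y : Matrix k k ℝ) (P : Matrix n k ℝ) :
    sylvester X Y P = P * Y - X * P := rfl

theorem sylvester_bijective
    [Fintype n] [Fintype k] [DecidableEq n] [DecidableEq k]
    {X : Matrix n n ℝ} {Y : Matrix k k ℝ}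
    (hXY : Disjoint (spectrum ℂ (X.map Complex.ofReal)) (spectrum ℂ (Y.map Complex.ofReal))) :
    Function.Bijective (sylvester X Y) := by
  have hinj : Function.Injective (sylvester X Y) := by
    refine (injective_iff_map_eq_zero _).2 fun P hP => eq_zero_of_mul_eq_mul_real hXY ?_
    exact (sub_eq_zero.1 hP).symm
  exact ⟨hinj, LinearMap.injective_iff_surjective.1 hinj⟩

theorem exists_trace_mul_eq
    [Fintype r] [Fintype k] [DecidableEq r] [DecidableEq k]
    (φ : Matrix r k ℝ →ₗ[ℝ] ℝ) :
    ∃ W : Matrix k r ℝ, ∀ X, φ X = (W * X).trace := by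
  refine ⟨of fun j i => φ (single i j 1), fun X => ?_⟩
  conv_lhs => rw [matrix_eq_sum_single X]
  simp only [map_sum, trace, diag_apply, mul_apply, of_apply]
  rw [Finset.sum_comm]
  refine Finset.sum_congr rfl fun j _ => Finset.sum_congr rfl fun i _ => ?_
  rw [← mul_one (X i j), ← smul_eq_mul (X i j), ← smul_single, map_smul, smul_eq_mul, mul_comm]
  simp

theorem eq_zero_of_forall_trace_mul_eq_zero [Fintype r] [Fintype k]
    {W : Matrix k r ℝ}
    (h : ∀ X : Matrix r k ℝ, (W * X).trace = 0) : W = 0 := by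
  exact trace_mul_conjTranspose_self_eq_zero_iff.1 (h Wᴴ)

/-- A linear map into matrices is surjective iff no nonzero matrix annihilates its range in the
trace pairing. -/
theorem surjective_iff_forall_trace
    [Fintype r] [Fintype k] [DecidableEq r] [DecidableEq k]
    {E : Type*} [AddCommGroup E] [Module ℝ E]
    (L : E →ₗ[ℝ] Matrix r k ℝ) :
    Function.Surjective L ↔ ∀ W : Matrix k r ℝ, (∀ x, (W * L x).trace = 0) → W = 0 := by
  refine ⟨fun hL W hW => eq_zero_of_forall_trace_mul_eq_zero fun X => ?_, fun h => ?_⟩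
  · obtain ⟨x, rfl⟩ := hL X
    exact hW x
  · rw [← LinearMap.range_eq_top]
    by_contra hne
    obtain ⟨φ, hφ, hle⟩ := Submodule.exists_le_ker_of_lt_top _ (lt_top_iff_ne_top.2 hne)
    obtain ⟨W, hW⟩ := exists_trace_mul_eq φ
    have hW0 : W = 0 := h W fun x => by
      rw [← hW]
      exact hle ⟨x, rfl⟩
    exact hφ (LinearMap.ext fun X => by simp [hW, hW0])

theorem rank_eq_card_iff_vecMul [Fintype n] [Fintype m]
    {R : Matrix n m ℂ} :
    R.rank = Fintype.card n ↔ ∀ w, w ᵥ* R = 0 → w = 0 := by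
  rw [rank_eq_finrank_span_row, eq_comm, ← Set.finrank,
    ← linearIndependent_iff_card_eq_finrank_span, ← vecMul_injective_iff]
  exact injective_iff_map_eq_zero (vecMulLinear R)

/-- The pairs `(V, W)` with `V A + W C = Φ V` and `V B + W D = 0` all vanish iff the Rosenbrock
matrix has independent rows at every eigenvalue of `Φ`. -/
theorem forall_eq_zero_iff_forall_rank_eq
    [Fintype n] [Fintype m] [Fintype r] [Fintype k] [DecidableEq n] [DecidableEq k]
    (A : Matrix n n ℂ) (B : Matrix n m ℂ)
    (C : Matrix r n ℂ) (D : Matrix r m ℂ) (Φ : Matrix k k ℂ) :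
    (∀ (V : Matrix k n ℂ) (W : Matrix k r ℂ),
        V * A + W * C = Φ * V → V * B + W * D = 0 → V = 0 ∧ W = 0) ↔
      ∀ μ ∈ spectrum ℂ Φ,
        (fromBlocks (A - μ • (1 : Matrix n n ℂ)) B C D).rank
          = Fintype.card n + Fintype.card r := by
  simp only [← Fintype.card_sum, rank_eq_card_iff_vecMul]
  constructor
  · intro h μ hμ w hw
    obtain ⟨v, hv, hΦ⟩ := exists_mulVec_eq_smul_of_mem_spectrum hμ
    rw [vecMul_fromBlocks] at hw
    have h₁ : (w ∘ Sum.inl) ᵥ* A + (w ∘ Sum.inr) ᵥ* C = μ • (w ∘ Sum.inl) := by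
      have := congrArg (· ∘ Sum.inl) hw
      simp only [Sum.elim_comp_inl, vecMul_sub, vecMul_smul, vecMul_one] at this
      rw [← sub_eq_zero, add_sub_right_comm]
      exact this
    have h₂ : (w ∘ Sum.inl) ᵥ* B + (w ∘ Sum.inr) ᵥ* D = 0 := by
      have := congrArg (· ∘ Sum.inr) hw
      simp only [Sum.elim_comp_inr] at this
      exact this
    obtain ⟨hV, hW⟩ := h (vecMulVec v (w ∘ Sum.inl)) (vecMulVec v (w ∘ Sum.inr))
      (by rw [vecMulVec_mul, vecMulVec_mul, mul_vecMulVec, ← vecMulVec_add, h₁, hΦ,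
            vecMulVec_smul, smul_vecMulVec])
      (by rw [vecMulVec_mul, vecMulVec_mul, ← vecMulVec_add, h₂]; ext; simp [vecMulVec_apply])
    obtain ⟨j, hj⟩ := Function.ne_iff.1 hv
    funext i
    rcases i with i | i
    · simpa [vecMulVec_apply, show v j ≠ 0 from hj] using congrFun₂ hV j i
    · simpa [vecMulVec_apply, show v j ≠ 0 from hj] using congrFun₂ hW j i
  · intro h V W h₁ h₂
    by_contra hne
    let S : Submodule ℂ (Matrix k n ℂ × Matrix k r ℂ) :=
      { carrier := {Z | Z.1 * A + Z.2 * C = Φ * Z.1 ∧ Z.1 * B + Z.2 * D = 0}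
        zero_mem' := by simp
        add_mem' := by
          rintro X Y ⟨hX₁, hX₂⟩ ⟨hY₁, hY₂⟩
          refine ⟨?_, ?_⟩
          · simp only [Prod.fst_add, Prod.snd_add, Matrix.add_mul, Matrix.mul_add, ← hX₁, ← hY₁]
            abel
          · simp only [Prod.fst_add, Prod.snd_add, Matrix.add_mul]
            rw [add_add_add_comm, hX₂, hY₂, add_zero]
        smul_mem' := by
          rintro c X ⟨hX₁, hX₂⟩
          refine ⟨?_, ?_⟩
          · simp only [Prod.smul_fst, Prod.smul_snd, Matrix.smul_mul, Matrix.mul_smul,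
              ← smul_add, hX₁]
          · simp only [Prod.smul_fst, Prod.smul_snd, Matrix.smul_mul, ← smul_add, hX₂, smul_zero] }
    obtain ⟨μ, ⟨V', W'⟩, ⟨h₁', h₂'⟩, hne', hμ⟩ := Module.End.exists_eigenvector_mem
      ((mulLeftLinearMap n ℂ Φ).prodMap (mulLeftLinearMap r ℂ Φ)) S
      (by
        rintro ⟨X, Y⟩ ⟨h₁, h₂⟩
        refine ⟨?_, ?_⟩
        · change Φ * X * A + Φ * Y * C = Φ * (Φ * X)
          rw [Matrix.mul_assoc, Matrix.mul_assoc, ← Matrix.mul_add]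
          exact congrArg (Φ * ·) h₁
        · change Φ * X * B + Φ * Y * D = 0
          rw [Matrix.mul_assoc, Matrix.mul_assoc, ← Matrix.mul_add]
          exact (congrArg (Φ * ·) h₂).trans (Matrix.mul_zero _))
      (x := (V, W)) ⟨h₁, h₂⟩ (fun h0 => hne (Prod.mk_eq_zero.1 h0))
    have hV : Φ * V' = μ • V' := congrArg Prod.fst hμ
    have hW : Φ * W' = μ • W' := congrArg Prod.snd hμ
    have hspec : μ ∈ spectrum ℂ Φ := by
      by_cases hV0 : V' = 0
      · refine mem_spectrum_of_mul_eq_smul (fun hW0 => hne' ?_) hW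
        rw [hV0, hW0, Prod.mk_zero_zero]
      · exact mem_spectrum_of_mul_eq_smul hV0 hV
    have h₁' : V' * A + W' * C = Φ * V' := h₁'
    have h₂' : V' * B + W' * D = 0 := h₂'
    rw [hV] at h₁'
    have key (j : k) : Sum.elim (V' j) (W' j) = 0 := by
      refine h μ hspec _ ?_
      rw [vecMul_fromBlocks, Sum.elim_comp_inl, Sum.elim_comp_inr, vecMul_sub, vecMul_smul,
        vecMul_one, ← add_sub_right_comm]
      have e₁ : V' j ᵥ* A + W' j ᵥ* C = μ • V' j := congrFun h₁' j
      have e₂ : V' j ᵥ* B + W' j ᵥ* D = 0 := congrFun h₂' j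
      rw [e₁, e₂, sub_self]
      exact Sum.elim_zero_zero
    refine hne' (Prod.ext ?_ ?_)
    · ext j i
      exact congrFun (key j) (Sum.inl i)
    · ext j i
      exact congrFun (key j) (Sum.inr i)

theorem map_re_mul_ofReal [Fintype m]
    (X : Matrix n m ℂ) (Y : Matrix m k ℝ) :
    (X * Y.map Complex.ofReal).map re = X.map re * Y := by
  ext i j
  simp [mul_apply]

theorem map_im_mul_ofReal [Fintype m]
    (X : Matrix n m ℂ) (Y : Matrix m k ℝ) :
    (X * Y.map Complex.ofReal).map im = X.map im * Y := by
  ext i j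
  simp [mul_apply]

theorem map_re_ofReal_mul [Fintype m]
    (X : Matrix n m ℝ) (Y : Matrix m k ℂ) :
    (X.map Complex.ofReal * Y).map re = X * Y.map re := by
  ext i j
  simp [mul_apply]

theorem map_im_ofReal_mul [Fintype m]
    (X : Matrix n m ℝ) (Y : Matrix m k ℂ) :
    (X.map Complex.ofReal * Y).map im = X * Y.map im := by
  ext i j
  simp [mul_apply]

theorem forall_eq_zero_complex_iff_real [Fintype n] [Fintype r] [Fintype k]
    (A : Matrix n n ℝ) (B : Matrix n m ℝ)
    (C : Matrix r n ℝ) (D : Matrix r m ℝ) (Φ : Matrix k k ℝ) :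
    (∀ (V : Matrix k n ℂ) (W : Matrix k r ℂ),
        V * A.map Complex.ofReal + W * C.map Complex.ofReal = Φ.map Complex.ofReal * V →
        V * B.map Complex.ofReal + W * D.map Complex.ofReal = 0 → V = 0 ∧ W = 0) ↔
      ∀ (V : Matrix k n ℝ) (W : Matrix k r ℝ),
        V * A + W * C = Φ * V → V * B + W * D = 0 → V = 0 ∧ W = 0 := by
  constructor
  · intro h V W h₁ h₂
    obtain ⟨hV, hW⟩ := h (V.map Complex.ofReal) (W.map Complex.ofReal)
      (by rw [← map_ofReal_mul, ← map_ofReal_mul, ← map_ofReal_mul,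
            ← Matrix.map_add _ ofReal_add, h₁])
      (by rw [← map_ofReal_mul, ← map_ofReal_mul, ← Matrix.map_add _ ofReal_add, h₂]
          ext; simp)
    constructor
    · ext i j
      simpa using congrFun₂ hV i j
    · ext i j
      simpa using congrFun₂ hW i j
  · intro h V W h₁ h₂
    obtain ⟨hVr, hWr⟩ := h (V.map re) (W.map re)
      (by rw [← map_re_mul_ofReal, ← map_re_mul_ofReal, ← map_re_ofReal_mul,
            ← Matrix.map_add _ add_re, h₁])
      (by rw [← map_re_mul_ofReal, ← map_re_mul_ofReal, ← Matrix.map_add _ add_re, h₂]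
          ext; simp)
    obtain ⟨hVi, hWi⟩ := h (V.map im) (W.map im)
      (by rw [← map_im_mul_ofReal, ← map_im_mul_ofReal, ← map_im_ofReal_mul,
            ← Matrix.map_add _ add_im, h₁])
      (by rw [← map_im_mul_ofReal, ← map_im_mul_ofReal, ← Matrix.map_add _ add_im, h₂]
          ext; simp)
    constructor
    · ext i j
      exact Complex.ext (congrFun₂ hVr i j) (congrFun₂ hVi i j)
    · ext i j
      exact Complex.ext (congrFun₂ hWr i j) (congrFun₂ hWi i j)

/-- If `V A + W C = Φ V`, then pairing `W` with the output of the steady state `P` forced by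
`P Φ - A P = B F` amounts to pairing `V B + W D` with the input `F`. -/
theorem trace_mul_steadyState
    [Fintype n] [Fintype m] [Fintype r] [Fintype k]
    {A : Matrix n n ℝ} {B : Matrix n m ℝ}
    {C : Matrix r n ℝ} {D : Matrix r m ℝ} {Φ : Matrix k k ℝ} {V : Matrix k n ℝ}
    {W : Matrix k r ℝ} {P : Matrix n k ℝ} {F : Matrix m k ℝ}
    (hV : V * A + W * C = Φ * V) (hP : P * Φ - A * P = B * F) :
    (W * (C * P + D * F)).trace = ((V * B + W * D) * F).trace := by
  have hWC : W * C = Φ * V - V * A := eq_sub_of_add_eq' hV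
  rw [Matrix.mul_add, Matrix.add_mul, trace_add, trace_add, ← Matrix.mul_assoc W C, hWC,
    Matrix.mul_assoc V B, ← hP, Matrix.mul_sub, Matrix.sub_mul, trace_sub, trace_sub,
    Matrix.mul_assoc Φ, trace_mul_comm Φ, Matrix.mul_assoc V P, Matrix.mul_assoc V A,
    Matrix.mul_assoc W D]

end Matrix

/-- with `A` Hurwitz and `Φ` having purely imaginary spectrum, the steady-state
loop gain operator `ℒ(F) = C·Syl⁻¹(BF) + DF` (where `Syl(Π) = ΠΦ − AΠ`) is surjective iff
for every eigenvalue `λ` of `Φ`, `rank [[A − λI, B], [C, D]] = n + r`. -/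
theorem sslg_surjective_iff (n m r N : ℕ)
    (A : Matrix (Fin n) (Fin n) ℝ) (B : Matrix (Fin n) (Fin m) ℝ)
    (C : Matrix (Fin r) (Fin n) ℝ) (D : Matrix (Fin r) (Fin m) ℝ)
    (Φ : Matrix (Fin N) (Fin N) ℝ)
    (hA : ∀ μ ∈ spectrum ℂ (A.map (Complex.ofReal)), μ.re < 0)
    (hΦ : ∀ μ ∈ spectrum ℂ (Φ.map (Complex.ofReal)), μ.re = 0) :
    Function.Surjective
        (fun F : Matrix (Fin m) (Fin N) ℝ =>
          C * (Function.invFun (fun P : Matrix (Fin n) (Fin N) ℝ => P * Φ - A * P) (B * F))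
            + D * F) ↔
      ∀ lam ∈ spectrum ℂ (Φ.map (Complex.ofReal)),
        (Matrix.fromBlocks (A.map (Complex.ofReal) - lam • (1 : Matrix (Fin n) (Fin n) ℂ))
            (B.map (Complex.ofReal)) (C.map (Complex.ofReal)) (D.map (Complex.ofReal))).rank
          = n + r := by
  have hdisj : Disjoint (spectrum ℂ (A.map Complex.ofReal)) (spectrum ℂ (Φ.map Complex.ofReal)) :=
    Set.disjoint_left.2 fun μ h₁ h₂ => (hA μ h₁).ne (hΦ μ h₂)
  let e := LinearEquiv.ofBijective (sylvester A Φ) (sylvester_bijective hdisj)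
  have he (Q : Matrix (Fin n) (Fin N) ℝ) : e.symm Q * Φ - A * e.symm Q = Q := e.apply_symm_apply Q
  have hinv (Q : Matrix (Fin n) (Fin N) ℝ) :
      Function.invFun (fun P : Matrix (Fin n) (Fin N) ℝ => P * Φ - A * P) Q = e.symm Q :=
    e.injective ((Function.invFun_eq (f := fun P : Matrix (Fin n) (Fin N) ℝ => P * Φ - A * P)
      ⟨e.symm Q, he Q⟩).trans (he Q).symm)
  let L : Matrix (Fin m) (Fin N) ℝ →ₗ[ℝ] Matrix (Fin r) (Fin N) ℝ :=
    mulLeftLinearMap (Fin N) ℝ C ∘ₗ e.symm.toLinearMap ∘ₗ mulLeftLinearMap (Fin N) ℝ B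
      + mulLeftLinearMap (Fin N) ℝ D
  have hL (F : Matrix (Fin m) (Fin N) ℝ) : L F = C * e.symm (B * F) + D * F := rfl
  have hrank := forall_eq_zero_iff_forall_rank_eq (A.map Complex.ofReal) (B.map Complex.ofReal)
    (C.map Complex.ofReal) (D.map Complex.ofReal) (Φ.map Complex.ofReal)
  simp only [Fintype.card_fin] at hrank
  rw [← hrank, forall_eq_zero_complex_iff_real]
  simp only [hinv, ← hL]
  refine (surjective_iff_forall_trace L).trans ⟨fun h V W h₁ h₂ => ?_, fun h W hW => ?_⟩
  · have hW : W = 0 := h W fun F => by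
      rw [hL, trace_mul_steadyState h₁ (he _), h₂, Matrix.zero_mul, trace_zero]
    rw [hW, Matrix.zero_mul, add_zero] at h₁
    exact ⟨eq_zero_of_mul_eq_mul_real hdisj.symm h₁.symm, hW⟩
  · obtain ⟨V, hV⟩ := (sylvester_bijective hdisj.symm).2 (-(W * C))
    have hV : V * A + W * C = Φ * V := by
      rw [sylvester_apply] at hV
      rw [← sub_eq_zero, add_sub_right_comm, hV, neg_add_cancel]
    refine (h V W hV (eq_zero_of_forall_trace_mul_eq_zero fun F => ?_)).2
    rw [← trace_mul_steadyState hV (he _), ← hL, hW]
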